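/- There exists an absolute constant c > 0 such that for every integer N > 1 one can find a permutation σ of {1,…,N} with ‖T_{σ,N}‖_{L²→L^{2,∞}} ≥ c·√(log N). -/

import Mathlib

open MeasureTheory Filter

/-- The complex exponential `e^{2πinx}`. -/
noncomputable def trigChar (n : ℤ) (x : ℝ) : ℂ :=
  Complex.exp (2 * Real.pi * Complex.I * n * x)

/-- The `L²` norm over one period `[0,1]` of the torus `𝕋 = ℝ/ℤ`. -/
noncomputable def l2normT {E : Type*} [NormedAddCommGroup E] (f : ℝ → E) : ℝ :=
  (∫ x in (0:ℝ)..1, ‖f x‖ ^ 2) ^ ((1:ℝ)/2)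

/-- The `n`-th Fourier coefficient of `f : 𝕋 → ℂ`. -/
noncomputable def fourierCoef (f : ℝ → ℂ) (n : ℤ) : ℂ :=
  ∫ x in (0:ℝ)..1, f x * Complex.exp (-(2 * Real.pi * Complex.I * n * x))

/-- The maximal operator of partial sums of the `σ`-rearranged trigonometric system. -/
noncomputable def Tmax (N : ℕ) (σ : ℕ → ℕ) (f : ℝ → ℂ) (x : ℝ) : ℝ :=
  ⨆ m : Finset.Icc 1 N,
    ‖∑ k ∈ Finset.Icc 1 (m : ℕ), fourierCoef f (σ k : ℤ) * trigChar (σ k : ℤ) x‖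


lemma sort_exists (N : ℕ) (r : ℕ → ℕ) : ∃ σ : ℕ → ℕ, Set.BijOn σ (Set.Icc 1 N) (Set.Icc 1 N) ∧
    ∀ t, ∃ m ≤ N, ∀ g : ℕ → ℂ, ∑ k ∈ Finset.Icc 1 m, g (σ k) =
      ∑ μ ∈ (Finset.Icc 1 N).filter (fun μ => r μ ≤ t), g μ := by
  classical
  let F : Fin N → ℕ := fun i => r (i + 1)
  let s := Tuple.sort F
  have hs : Monotone (F ∘ s) := Tuple.monotone_sort F
  let σ : ℕ → ℕ := fun k => if h : k - 1 < N then (s ⟨k - 1, h⟩ : ℕ) + 1 else k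
  have hσ : ∀ k (h : k - 1 < N), σ k = (s ⟨k - 1, h⟩ : ℕ) + 1 := fun k h => by simp [σ, h]
  have hb : Set.BijOn σ (Set.Icc 1 N) (Set.Icc 1 N) := by
    refine ⟨?_, ?_, ?_⟩
    · intro k hk
      have h : k - 1 < N := by have := hk.1; have := hk.2; omega
      rw [hσ k h]
      have := (s ⟨k - 1, h⟩).2
      constructor <;> omega
    · intro k hk l hl he
      have h : k - 1 < N := by have := hk.1; have := hk.2; omega
      have h' : l - 1 < N := by have := hl.1; have := hl.2; omega
      rw [hσ k h, hσ l h'] at he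
      have h2 : s ⟨k - 1, h⟩ = s ⟨l - 1, h'⟩ := Fin.ext (by omega)
      have h3 := s.injective h2
      simp only [Fin.mk.injEq] at h3
      have := hk.1; have := hl.1; omega
    · intro μ hμ
      have h : μ - 1 < N := by have := hμ.1; have := hμ.2; omega
      refine ⟨(s.symm ⟨μ - 1, h⟩ : ℕ) + 1, ⟨by omega, by have := (s.symm ⟨μ - 1, h⟩).2; omega⟩, ?_⟩
      rw [hσ _ (by simp)]
      have := hμ.1
      simp; omega
  have hmono : ∀ k l, 1 ≤ k → k ≤ l → l ≤ N → r (σ k) ≤ r (σ l) := by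
    intro k l hk hkl hl
    rw [hσ k (by omega), hσ l (by omega)]
    exact hs (show (⟨k - 1, by omega⟩ : Fin N) ≤ ⟨l - 1, by omega⟩ from by
      simp only [Fin.mk_le_mk]; omega)
  refine ⟨σ, hb, fun t => ?_⟩
  let A := (Finset.Icc 1 N).filter (fun k => r (σ k) ≤ t)
  have hA : Finset.Icc 1 (A.sup id) = A := by
    ext k
    simp only [Finset.mem_Icc]
    constructor
    · rintro ⟨h1, h2⟩
      have hne : A.Nonempty := by
        by_contra h
        rw [Finset.not_nonempty_iff_eq_empty] at h
        simp [h] at h2; omega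
      obtain ⟨l, hl, hle⟩ := Finset.exists_mem_eq_sup A hne id
      rw [hle] at h2
      simp only [A, Finset.mem_filter, Finset.mem_Icc, id] at hl h2 ⊢
      exact ⟨⟨h1, by omega⟩, (hmono k l h1 h2 hl.1.2).trans hl.2⟩
    · intro hk
      exact ⟨(Finset.mem_Icc.1 (Finset.mem_filter.1 hk).1).1, Finset.le_sup (f := id) hk⟩
  refine ⟨A.sup id, Finset.sup_le fun k hk => (Finset.mem_Icc.1 (Finset.mem_filter.1 hk).1).2, ?_⟩
  intro g
  rw [hA]
  refine Finset.sum_nbij σ ?_ ?_ ?_ (fun _ _ => rfl)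
  · intro k hk
    simp only [A, Finset.mem_filter, Finset.mem_Icc] at hk ⊢
    exact ⟨hb.mapsTo hk.1, hk.2⟩
  · intro k hk l hl
    simp only [A, Finset.coe_filter, Finset.mem_Icc, Set.mem_ofPred_eq] at hk hl
    exact hb.injOn hk.1 hl.1
  · intro μ hμ
    simp only [Finset.coe_filter, Finset.mem_Icc, Set.mem_ofPred_eq] at hμ
    obtain ⟨k, hk, rfl⟩ := hb.surjOn (show μ ∈ Set.Icc 1 N from hμ.1)
    exact ⟨k, by simp only [A, Finset.coe_filter, Finset.mem_Icc, Set.mem_ofPred_eq]; exact ⟨hk, hμ.2⟩, rfl⟩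

/-- `e^{2πit}` -/
noncomputable def ex (t : ℝ) : ℂ := Complex.exp (2 * Real.pi * Complex.I * t)

lemma ex_add (s t : ℝ) : ex (s + t) = ex s * ex t := by
  simp only [ex, ← Complex.exp_add]; congr 1; push_cast; ring

lemma ex_zero : ex 0 = 1 := by simp [ex]

lemma ex_int (n : ℤ) : ex n = 1 := by
  rw [ex, Complex.exp_eq_one_iff]; exact ⟨n, by push_cast; ring⟩

lemma ex_eq_one {t : ℝ} (h : ex t = 1) : ∃ n : ℤ, t = n := by
  rw [ex, Complex.exp_eq_one_iff] at h
  obtain ⟨n, hn⟩ := h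
  refine ⟨n, ?_⟩
  have : (2 * Real.pi * Complex.I : ℂ) ≠ 0 := Complex.two_pi_I_ne_zero
  have h2 : (t : ℂ) = n := mul_left_cancel₀ this (by rw [hn]; ring)
  exact_mod_cast h2

lemma ex_ne_zero (t : ℝ) : ex t ≠ 0 := Complex.exp_ne_zero _

lemma norm_ex (t : ℝ) : ‖ex t‖ = 1 := by
  rw [ex, show (2 * Real.pi * Complex.I * t : ℂ) = ((2 * Real.pi * t : ℝ) : ℂ) * Complex.I by
    push_cast; ring]
  exact Complex.norm_exp_ofReal_mul_I _

lemma conj_ex (t : ℝ) : (starRingEnd ℂ) (ex t) = ex (-t) := by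
  rw [ex, ← Complex.exp_conj, ex]; congr 1; simp [map_ofNat]

lemma norm_ex_sub_one (t : ℝ) : ‖ex t - 1‖ ≤ 2 * Real.pi * |t| := by
  rw [ex, show (2 * Real.pi * Complex.I * t : ℂ) = Complex.I * ((2 * Real.pi * t : ℝ) : ℂ) by
    push_cast; ring]
  refine (Real.norm_exp_I_mul_ofReal_sub_one_le).trans ?_
  rw [Real.norm_eq_abs, abs_mul, abs_of_pos Real.two_pi_pos]

lemma trigChar_eq (n : ℤ) (x : ℝ) : trigChar n x = ex (n * x) := by
  simp only [trigChar, ex]; congr 1; push_cast; ring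

lemma continuous_ex : Continuous ex := by unfold ex; fun_prop

lemma integral_ex (n : ℤ) : ∫ x in (0:ℝ)..1, ex (n * x) = if n = 0 then 1 else 0 := by
  split_ifs with h
  · simp [h, ex_zero]
  · have hc : (2 * Real.pi * Complex.I * n : ℂ) ≠ 0 :=
      mul_ne_zero Complex.two_pi_I_ne_zero (by exact_mod_cast h)
    have := integral_exp_mul_complex (a := 0) (b := 1) hc
    have h2 : ∀ x : ℝ, ex (n * x) = Complex.exp (2 * Real.pi * Complex.I * n * x) := by
      intro x; rw [← trigChar_eq]; rfl
    simp only [h2, this]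
    have h1 := ex_int n
    rw [ex] at h1
    push_cast at h1
    simp [h1]

lemma fourierCoef_sum {β : Type*} (B : Finset β) (fr : β → ℤ) (c : β → ℂ) (μ : ℤ) :
    fourierCoef (fun x => ∑ b ∈ B, c b * ex (fr b * x)) μ = ∑ b ∈ B, if fr b = μ then c b else 0 := by
  unfold fourierCoef
  have h : ∀ x : ℝ, (∑ b ∈ B, c b * ex (fr b * x)) *
      Complex.exp (-(2 * Real.pi * Complex.I * μ * x)) =
      ∑ b ∈ B, c b * ex ((fr b - μ : ℤ) * x) := by
    intro x
    rw [Finset.sum_mul]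
    refine Finset.sum_congr rfl fun b _ => ?_
    rw [mul_assoc]; congr 1
    simp only [ex, ← Complex.exp_add]; congr 1; push_cast; ring
  simp only [h]
  rw [intervalIntegral.integral_finsetSum]
  · refine Finset.sum_congr rfl fun b _ => ?_
    rw [intervalIntegral.integral_const_mul, integral_ex]
    simp [sub_eq_zero]
  · intro b _
    apply Continuous.intervalIntegrable
    have := continuous_ex
    fun_prop

lemma transfer {ι β : Type*} (J : Finset ι) (B : Finset β) (fr : β → ℤ) (c : ι → β → ℂ)
    (ρ : ι → ℕ) (N : ℕ) (hfr : ∀ b ∈ B, 1 ≤ fr b ∧ fr b ≤ N)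
    (hdis : ∀ I ∈ J, ∀ I' ∈ J, ∀ b ∈ B, ∀ b' ∈ B, fr b = fr b' → c I b ≠ 0 → c I' b' ≠ 0 → I = I') :
    ∃ σ : ℕ → ℕ, Set.BijOn σ (Set.Icc 1 N) (Set.Icc 1 N) ∧
      ∀ t x, ‖∑ I ∈ J with ρ I ≤ t, ∑ b ∈ B, c I b * ex (fr b * x)‖ ≤
        Tmax N σ (fun x => ∑ I ∈ J, ∑ b ∈ B, c I b * ex (fr b * x)) x := by
  classical
  let r : ℕ → ℕ := fun μ => if h : ∃ I ∈ J, ∃ b ∈ B, fr b = μ ∧ c I b ≠ 0 then ρ h.choose else 0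
  have hr : ∀ I ∈ J, ∀ b ∈ B, c I b ≠ 0 → r (fr b).toNat = ρ I := by
    intro I hI b hb hc
    have hpos := (hfr b hb).1
    have h : ∃ I ∈ J, ∃ b' ∈ B, fr b' = ((fr b).toNat : ℕ) ∧ c I b' ≠ 0 :=
      ⟨I, hI, b, hb, by omega, hc⟩
    simp only [r, dif_pos h]
    obtain ⟨h1, b', hb', h2, h3⟩ := h.choose_spec
    rw [hdis _ h1 I hI b' hb' b hb (by omega) h3 hc]
  obtain ⟨σ, hσ, hσ2⟩ := sort_exists N r
  refine ⟨σ, hσ, fun t x => ?_⟩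
  set f : ℝ → ℂ := fun x => ∑ I ∈ J, ∑ b ∈ B, c I b * ex (fr b * x) with hf
  have hf2 : f = fun x => ∑ b ∈ B, (∑ I ∈ J, c I b) * ex (fr b * x) := by
    funext x
    simp only [hf, Finset.sum_mul]
    rw [Finset.sum_comm]
  obtain ⟨m, hm, hsum⟩ := hσ2 t
  have key : ∑ k ∈ Finset.Icc 1 m, fourierCoef f (σ k : ℤ) * trigChar (σ k : ℤ) x =
      ∑ I ∈ J with ρ I ≤ t, ∑ b ∈ B, c I b * ex (fr b * x) := by
    rw [hsum (fun μ => fourierCoef f (μ : ℤ) * trigChar (μ : ℤ) x)]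
    simp only [trigChar_eq]
    simp only [hf2]
    simp only [fourierCoef_sum]
    simp only [Finset.sum_mul _ _ (ex _)]
    rw [Finset.sum_comm]
    rw [Finset.sum_comm (s := J.filter _)]
    refine Finset.sum_congr rfl fun b hb => ?_
    have hpos := hfr b hb
    have hcast : ((fr b).toNat : ℤ) = fr b := by omega
    have e1 : ∀ μ ∈ (Finset.Icc 1 N).filter (fun μ => r μ ≤ t),
        (if fr b = (μ : ℤ) then ∑ I ∈ J, c I b else 0) * ex ((μ : ℤ) * x) =
        if μ = (fr b).toNat then (∑ I ∈ J, c I b) * ex (fr b * x) else 0 := by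
      intro μ _
      by_cases h : fr b = (μ : ℤ)
      · have : μ = (fr b).toNat := by omega
        rw [if_pos h, if_pos this, h]
      · have : ¬ μ = (fr b).toNat := by omega
        rw [if_neg h, if_neg this, zero_mul]
    rw [Finset.sum_congr rfl e1, Finset.sum_ite_eq']
    rw [← Finset.sum_mul]
    have hmem : ((fr b).toNat ∈ (Finset.Icc 1 N).filter (fun μ => r μ ≤ t)) ↔ r (fr b).toNat ≤ t := by
      simp only [Finset.mem_filter, Finset.mem_Icc]; omega
    simp only [hmem]
    rw [Finset.sum_filter]
    split_ifs with h
    · congr 1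
      refine Finset.sum_congr rfl fun I hI => ?_
      by_cases hc : c I b = 0
      · simp [hc]
      · rw [hr I hI b hb hc] at h; simp [h]
    · symm
      rw [Finset.sum_eq_zero, zero_mul]
      intro I hI
      by_cases hc : c I b = 0
      · simp [hc]
      · rw [hr I hI b hb hc] at h; simp [h]
  rw [← key]
  unfold Tmax
  have hbdd : BddAbove (Set.range fun m : Finset.Icc 1 N =>
      ‖∑ k ∈ Finset.Icc 1 (m : ℕ), fourierCoef f (σ k : ℤ) * trigChar (σ k : ℤ) x‖) :=
    Set.Finite.bddAbove (Set.finite_range _)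
  rcases Nat.eq_zero_or_pos m with h0 | h0
  · subst h0
    simp only [Finset.Icc_eq_empty_of_lt Nat.zero_lt_one, Finset.sum_empty, norm_zero]
    exact Real.iSup_nonneg fun _ => norm_nonneg _
  · exact le_ciSup hbdd ⟨m, Finset.mem_Icc.2 ⟨h0, hm⟩⟩

noncomputable def Dk (Q : ℕ) (t : ℝ) : ℂ := (1 / Q : ℂ) * ∑ i ∈ Finset.range Q, ex (i * t)

noncomputable def Fj (Q : ℕ) (t : ℝ) : ℝ := ‖Dk Q t‖ ^ 2

lemma Fj_nonneg (Q : ℕ) (t : ℝ) : 0 ≤ Fj Q t := by unfold Fj; positivity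

lemma Fj_continuous (Q : ℕ) : Continuous (Fj Q) := by
  unfold Fj Dk
  have := continuous_ex
  fun_prop

lemma Fj_expand (Q : ℕ) (t : ℝ) : (Fj Q t : ℂ) =
    (1 / Q : ℂ) ^ 2 * ∑ i ∈ Finset.range Q, ∑ j ∈ Finset.range Q, ex (((i : ℤ) - (j : ℤ) : ℤ) * t) := by
  have h : (Fj Q t : ℂ) = Dk Q t * (starRingEnd ℂ) (Dk Q t) := by
    rw [Complex.mul_conj, Complex.normSq_eq_norm_sq, Fj]
  rw [h, Dk]
  simp only [map_mul, map_sum, conj_ex, map_div₀, map_one, map_natCast]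
  rw [show ∀ a b c d : ℂ, a * b * (c * d) = (a * c) * (b * d) from fun a b c d => by ring,
    Finset.sum_mul_sum, ← sq]
  congr 1
  refine Finset.sum_congr rfl fun i _ => Finset.sum_congr rfl fun j _ => ?_
  rw [← ex_add]; congr 1; push_cast; ring

lemma Fj_periodic (Q : ℕ) (t : ℝ) (n : ℤ) : Fj Q (t + n) = Fj Q t := by
  unfold Fj Dk
  congr 3
  refine Finset.sum_congr rfl fun i _ => ?_
  rw [mul_add, ex_add, show (i : ℝ) * (n : ℝ) = ((i * n : ℤ) : ℝ) by push_cast; ring, ex_int, mul_one]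

lemma sum_ex_root (Q : ℕ) (hQ : 0 < Q) (m : ℤ) (h1 : |m| < Q) :
    ∑ y ∈ Finset.range Q, ex (-(m * y / Q)) = if m = 0 then (Q : ℂ) else 0 := by
  have hQ' : (Q : ℝ) ≠ 0 := by positivity
  split_ifs with h
  · simp [h, ex_zero]
  · have hpow : ∀ y : ℕ, ex (-(m * y / Q)) = ex (-(m / Q)) ^ y := by
      intro y
      induction y with
      | zero => simp [ex_zero]
      | succ y ih =>
        rw [pow_succ, ← ih, ← ex_add]; congr 1; push_cast; ring
    simp only [hpow]
    have hne : ex (-(m / Q)) ≠ 1 := by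
      intro he
      obtain ⟨n, hn⟩ := ex_eq_one he
      have h3 : -(m : ℝ) = n * Q := by field_simp at hn; linarith
      have h4 : -m = n * Q := by exact_mod_cast h3
      have h5 : (Q : ℤ) ∣ m := ⟨-n, by linarith⟩
      exact h (Int.eq_zero_of_abs_lt_dvd h5 h1)
    rw [geom_sum_eq hne, ← hpow]
    rw [show (-((m : ℝ) * (Q : ℝ) / Q)) = ((-m : ℤ) : ℝ) by push_cast; field_simp, ex_int]
    simp

lemma Fj_sum (Q : ℕ) (hQ : 0 < Q) (t : ℝ) : ∑ y ∈ Finset.range Q, Fj Q (t - y / Q) = 1 := by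
  have hQ' : (Q : ℂ) ≠ 0 := by exact_mod_cast hQ.ne'
  have : ((∑ y ∈ Finset.range Q, Fj Q (t - y / Q) : ℝ) : ℂ) = 1 := by
    push_cast
    simp only [Fj_expand]
    rw [← Finset.mul_sum, Finset.sum_comm]
    have h : ∀ i ∈ Finset.range Q, ∑ y ∈ Finset.range Q, ∑ j ∈ Finset.range Q,
        ex (((i : ℤ) - (j : ℤ) : ℤ) * (t - y / Q)) = Q := by
      intro i hi
      rw [Finset.sum_comm]
      have h2 : ∀ j ∈ Finset.range Q, ∑ y ∈ Finset.range Q,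
          ex (((i : ℤ) - (j : ℤ) : ℤ) * (t - y / Q)) = if i = j then (Q : ℂ) else 0 := by
        intro j hj
        have h3 : ∀ y : ℕ, ex (((i : ℤ) - (j : ℤ) : ℤ) * (t - y / Q)) =
            ex (((i : ℤ) - (j : ℤ) : ℤ) * t) * ex (-(((i : ℤ) - (j : ℤ) : ℤ) * y / Q)) := by
          intro y; rw [← ex_add]; congr 1; ring
        simp only [h3]
        simp only [Finset.mem_range] at hi hj
        rw [← Finset.mul_sum, sum_ex_root Q hQ _ (by rw [abs_lt]; omega)]
        by_cases hij : i = j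
        · subst hij; simp [ex_zero]
        · have : ¬ ((i : ℤ) - j = 0) := by omega
          rw [if_neg this, if_neg hij, mul_zero]
      rw [Finset.sum_congr rfl h2, Finset.sum_ite_eq, if_pos hi]
    rw [Finset.sum_congr rfl h]
    simp
    field_simp
  exact_mod_cast this

lemma Fj_lower (Q : ℕ) (hQ : 0 < Q) (t δ : ℝ) (ht : |t| ≤ δ / Q) (hδ : 2 * Real.pi * δ ≤ 1) :
    1 - 4 * Real.pi * δ ≤ Fj Q t := by
  have hQ' : (0 : ℝ) < Q := by exact_mod_cast hQ
  have hQ2 : (Q : ℂ) ≠ 0 := by exact_mod_cast hQ.ne'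
  have h1 : ‖Dk Q t - 1‖ ≤ 2 * Real.pi * δ := by
    have : Dk Q t - 1 = (1 / Q : ℂ) * ∑ i ∈ Finset.range Q, (ex (i * t) - 1) := by
      rw [Finset.sum_sub_distrib, mul_sub, Dk]; simp; field_simp
    rw [this, norm_mul]
    have h2 : ‖∑ i ∈ Finset.range Q, (ex (i * t) - 1)‖ ≤ Q * (2 * Real.pi * δ) := by
      refine (norm_sum_le _ _).trans ?_
      have : ∀ i ∈ Finset.range Q, ‖ex (i * t) - 1‖ ≤ 2 * Real.pi * δ := by
        intro i hi
        refine (norm_ex_sub_one _).trans ?_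
        gcongr
        rw [abs_mul, Nat.abs_cast]
        have hi' : (i : ℝ) ≤ Q := by exact_mod_cast (Finset.mem_range.1 hi).le
        calc (i : ℝ) * |t| ≤ Q * (δ / Q) := by gcongr
          _ = δ := by field_simp
      refine (Finset.sum_le_sum this).trans ?_
      simp
    rw [norm_div, norm_one, Complex.norm_natCast]
    calc 1 / (Q : ℝ) * _ ≤ 1 / (Q : ℝ) * (Q * (2 * Real.pi * δ)) := by gcongr
      _ = _ := by field_simp
  have h3 : 1 - 2 * Real.pi * δ ≤ ‖Dk Q t‖ := by
    have := norm_sub_norm_le (1 : ℂ) (1 - Dk Q t)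
    rw [norm_one, norm_sub_rev 1 (Dk Q t)] at this
    simp at this
    linarith
  unfold Fj
  have h4 := pow_le_pow_left₀ (by linarith) h3 2
  nlinarith [sq_nonneg (2 * Real.pi * δ)]

noncomputable def W (Q R : ℕ) (y z : ℕ) (x : ℝ) : ℝ := Fj Q (x - y / Q) * Fj Q (R * x - z / Q)

lemma W_nonneg (Q R y z : ℕ) (x : ℝ) : 0 ≤ W Q R y z x := mul_nonneg (Fj_nonneg _ _) (Fj_nonneg _ _)

lemma W_sum (Q R : ℕ) (hQ : 0 < Q) (x : ℝ) :
    ∑ y ∈ Finset.range Q, ∑ z ∈ Finset.range Q, W Q R y z x = 1 := by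
  simp only [W, ← Finset.mul_sum, Fj_sum Q hQ, mul_one]

/-- index set of quadruples -/
def Bq (Q : ℕ) : Finset ((ℕ × ℕ) × (ℕ × ℕ)) :=
  (Finset.range Q ×ˢ Finset.range Q) ×ˢ (Finset.range Q ×ˢ Finset.range Q)

def m1 (b : (ℕ × ℕ) × (ℕ × ℕ)) : ℤ := (b.1.1 : ℤ) - b.1.2
def m2 (b : (ℕ × ℕ) × (ℕ × ℕ)) : ℤ := (b.2.1 : ℤ) - b.2.2

lemma m_bound {Q : ℕ} {b} (hb : b ∈ Bq Q) : |m1 b| < Q ∧ |m2 b| < Q := by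
  simp only [Bq, Finset.mem_product, Finset.mem_range] at hb
  simp only [m1, m2, abs_lt]; omega

lemma W_expand (Q R y z : ℕ) (x : ℝ) : (W Q R y z x : ℂ) =
    (1 / Q : ℂ) ^ 4 * ∑ b ∈ Bq Q, ex (-((m1 b * y + m2 b * z) / Q)) *
      ex ((m1 b + R * m2 b : ℤ) * x) := by
  rw [W]; push_cast
  rw [Fj_expand, Fj_expand]
  rw [show ∀ a b c d : ℂ, a * b * (c * d) = (a * c) * (b * d) from fun a b c d => by ring]
  rw [← Finset.sum_product', ← Finset.sum_product', Finset.sum_mul_sum, ← Finset.sum_product']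
  congr 1
  · ring
  · refine Finset.sum_congr rfl fun b _ => ?_
    rw [← ex_add, ← ex_add]; congr 1; simp only [m1, m2]; push_cast; ring

lemma W_integral (Q R y z : ℕ) (hQ : 0 < Q) (hR : Q ≤ R) :
    ∫ x in (0:ℝ)..1, W Q R y z x = (1 / Q : ℝ) ^ 2 := by
  have hQ' : (Q : ℂ) ≠ 0 := by exact_mod_cast hQ.ne'
  have : ((∫ x in (0:ℝ)..1, W Q R y z x : ℝ) : ℂ) = (1 / Q : ℂ) ^ 2 := by
    rw [← intervalIntegral.integral_ofReal]
    simp only [W_expand]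
    rw [intervalIntegral.integral_const_mul, intervalIntegral.integral_finsetSum]
    · simp only [intervalIntegral.integral_const_mul, integral_ex]
      have h : ∀ b ∈ Bq Q, ex (-((m1 b * y + m2 b * z) / Q)) *
          (if m1 b + R * m2 b = 0 then (1 : ℂ) else 0) =
          (if b.1.1 = b.1.2 then 1 else 0) * (if b.2.1 = b.2.2 then 1 else 0) := by
        intro b hb
        have hm := m_bound hb
        by_cases h : m1 b + R * m2 b = 0
        · have h2 : (R : ℤ) ∣ m1 b := ⟨- m2 b, by linarith⟩
          have h3 := Int.eq_zero_of_abs_lt_dvd h2 (by have := hm.1; omega)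
          have h4 : m2 b = 0 := by
            rw [h3, zero_add] at h
            rcases mul_eq_zero.1 h with h | h
            · omega
            · exact h
          rw [if_pos h, h3, h4]
          simp only [m1, m2] at h3 h4
          rw [if_pos (by omega), if_pos (by omega)]
          simp [ex_zero]
        · rw [if_neg h]
          by_cases h5 : b.1.1 = b.1.2
          · by_cases h6 : b.2.1 = b.2.2
            · exact absurd (by simp [m1, m2, h5, h6]) h
            · simp [h6]
          · simp [h5]
      have hd : ∑ p ∈ Finset.range Q ×ˢ Finset.range Q, (if p.1 = p.2 then (1 : ℂ) else 0) = Q := by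
        rw [Finset.sum_product]
        have : ∀ i ∈ Finset.range Q, ∑ j ∈ Finset.range Q, (if i = j then (1 : ℂ) else 0) = 1 := by
          intro i hi
          rw [Finset.sum_ite_eq, if_pos hi]
        rw [Finset.sum_congr rfl this]; simp
      rw [Finset.sum_congr rfl h, Bq, Finset.sum_product]
      simp only []
      have h7 := Finset.sum_mul_sum (Finset.range Q ×ˢ Finset.range Q)
        (Finset.range Q ×ˢ Finset.range Q) (fun p => if p.1 = p.2 then (1 : ℂ) else 0)
        (fun p => if p.1 = p.2 then (1 : ℂ) else 0)
      rw [← h7, hd]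
      field_simp
    · intro b _
      apply Continuous.intervalIntegrable
      have := continuous_ex
      fun_prop
  apply Complex.ofReal_injective
  rw [this]; push_cast; rfl

noncomputable def hk (k : ℕ) (s : ℤ) : ℝ :=
  if (2 ^ (k + 1) : ℤ) ∣ s then 1 else if (2 ^ k : ℤ) ∣ s then -1 else 0

lemma hk_anti (k : ℕ) (s : ℤ) : hk k (s + 2 ^ k) = - hk k s := by
  unfold hk
  by_cases h : (2 ^ k : ℤ) ∣ s
  · obtain ⟨q, rfl⟩ := h
    have h0 : (2 ^ k : ℤ) ≠ 0 := by positivity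
    have e1 : (2 ^ (k + 1) : ℤ) ∣ 2 ^ k * q ↔ (2 : ℤ) ∣ q := by
      rw [pow_succ]; exact mul_dvd_mul_iff_left h0
    have e2 : (2 ^ (k + 1) : ℤ) ∣ 2 ^ k * q + 2 ^ k ↔ (2 : ℤ) ∣ q + 1 := by
      rw [pow_succ, show (2 : ℤ) ^ k * q + 2 ^ k = 2 ^ k * (q + 1) by ring]
      exact mul_dvd_mul_iff_left h0
    have e3 : (2 ^ k : ℤ) ∣ 2 ^ k * q + 2 ^ k := ⟨q + 1, by ring⟩
    simp only [e1, e2, e3, dvd_mul_right, if_true]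
    rcases Int.even_or_odd q with hq | hq
    · have h1 : (2 : ℤ) ∣ q := hq.two_dvd
      have h2 : ¬ (2 : ℤ) ∣ q + 1 := by omega
      simp [h1, h2]
    · have h1 : ¬ (2 : ℤ) ∣ q := by obtain ⟨r, hr⟩ := hq; omega
      have h2 : (2 : ℤ) ∣ q + 1 := by omega
      simp [h1, h2]
  · have h1 : ¬ (2 ^ (k + 1) : ℤ) ∣ s := fun h' => h ((pow_dvd_pow 2 (Nat.le_succ k)).trans h')
    have h2 : ¬ (2 ^ k : ℤ) ∣ s + 2 ^ k := by
      intro h'; exact h ((Int.dvd_add_left (dvd_refl _)).1 h')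
    have h3 : ¬ (2 ^ (k + 1) : ℤ) ∣ s + 2 ^ k :=
      fun h' => h2 ((pow_dvd_pow 2 (Nat.le_succ k)).trans h')
    simp [h, h1, h2, h3]

lemma hk_period (k : ℕ) (s d : ℤ) (h : (2 ^ (k + 1) : ℤ) ∣ d) : hk k (s + d) = hk k s := by
  unfold hk
  have h' : (2 ^ k : ℤ) ∣ d := (pow_dvd_pow 2 (Nat.le_succ k)).trans h
  simp only [Int.dvd_add_left h, Int.dvd_add_left h']

noncomputable def pk (k a : ℕ) (y z : ℤ) : ℝ := hk k (y - a * (1 + 2 * z))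

lemma pk_anti (k a : ℕ) (y z : ℤ) : pk k a (y + 2 ^ k) z = - pk k a y z := by
  unfold pk; rw [← hk_anti]; congr 1; ring

lemma pk_period (k a : ℕ) (y z d : ℤ) (h : (2 ^ (k + 1) : ℤ) ∣ d) :
    pk k a (y + d) z = pk k a y z := by
  unfold pk; rw [← hk_period k (y - a * (1 + 2 * z)) d h]; congr 1; ring

lemma pk_period_z (k a : ℕ) (y z d : ℤ) (h : (2 ^ (k + 1) : ℤ) ∣ d) :
    pk k a y (z + d) = pk k a y z := by
  unfold pk
  rw [← hk_period k (y - a * (1 + 2 * z)) (- (2 * a * d)) (by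
    rw [Int.dvd_neg]; exact h.mul_left _)]
  congr 1; ring

lemma pk_shift (k a : ℕ) (y z : ℤ) : pk k a (y + 2 * a) (z + 1) = pk k a y z := by
  unfold pk; congr 1; ring

lemma sum_shift {M : Type*} [AddCommGroup M] (Q : ℕ) (F : ℤ → M) (hF : ∀ y, F (y + Q) = F y) (s : ℕ) :
    ∑ y ∈ Finset.range Q, F (y + s) = ∑ y ∈ Finset.range Q, F y := by
  induction s with
  | zero => simp
  | succ s ih =>
    rw [← ih]
    have h1 := Finset.sum_range_succ (fun y : ℕ => F (y + s)) Q
    have h2 := Finset.sum_range_succ' (fun y : ℕ => F (y + s)) Q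
    rw [h1] at h2
    have h3 : F ((Q : ℤ) + s) = F (((0 : ℕ) : ℤ) + s) := by
      rw [add_comm, hF]; congr 1; push_cast; ring
    rw [h3] at h2
    rw [add_right_cancel h2]
    refine Finset.sum_congr rfl fun y _ => ?_
    congr 1; push_cast; ring

noncomputable def phat (n k a : ℕ) (u v : ℤ) : ℂ :=
  ∑ y ∈ Finset.range (2 ^ n), ∑ z ∈ Finset.range (2 ^ n),
    (pk k a y z : ℂ) * ex (-((u * y + v * z) / (2 ^ n : ℕ)))

lemma phat_ne {n k a : ℕ} {u v : ℤ} (hk : k < n) (h : phat n k a u v ≠ 0) :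
    (∃ j : ℤ, 2 ^ (k + 1) * u = 2 ^ n * (2 * j + 1)) ∧ (2 ^ n : ℤ) ∣ 2 * a * u + v := by
  have hdvd : (2 ^ (k + 1) : ℤ) ∣ ((2 ^ n : ℕ) : ℤ) := by push_cast; exact pow_dvd_pow 2 hk
  have hQ : ((2 ^ n : ℕ) : ℝ) ≠ 0 := by positivity
  set G : ℤ → ℤ → ℂ := fun y z => (pk k a y z : ℂ) * ex (-((u * y + v * z) / (2 ^ n : ℕ))) with hG
  have hGy : ∀ z y, G (y + (2 ^ n : ℕ)) z = G y z := by
    intro z y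
    simp only [hG]
    rw [pk_period _ _ _ _ _ hdvd]
    congr 1
    rw [show -(((u : ℝ) * ((y + ((2 ^ n : ℕ) : ℤ) : ℤ) : ℝ) + v * z) / ((2 ^ n : ℕ) : ℝ)) =
      -((u * y + v * z) / (2 ^ n : ℕ)) + ((-u : ℤ) : ℝ) by
        push_cast at hQ ⊢; field_simp; ring, ex_add, ex_int, mul_one]
  have hGz : ∀ y z, G y (z + (2 ^ n : ℕ)) = G y z := by
    intro y z
    simp only [hG]
    rw [pk_period_z _ _ _ _ _ hdvd]
    congr 1
    rw [show -(((u : ℝ) * y + v * ((z + ((2 ^ n : ℕ) : ℤ) : ℤ) : ℝ)) / ((2 ^ n : ℕ) : ℝ)) =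
      -((u * y + v * z) / (2 ^ n : ℕ)) + ((-v : ℤ) : ℝ) by
        push_cast at hQ ⊢; field_simp; ring, ex_add, ex_int, mul_one]
  have hp : phat n k a u v = ∑ z ∈ Finset.range (2 ^ n), ∑ y ∈ Finset.range (2 ^ n), G y z := by
    rw [phat, Finset.sum_comm]; simp only [hG, Int.cast_natCast]
  constructor
  · have h1 : phat n k a u v = -ex (-(u * 2 ^ k / (2 ^ n : ℕ))) * phat n k a u v := by
      conv_lhs => rw [hp]
      rw [hp, Finset.mul_sum]
      refine Finset.sum_congr rfl fun z _ => ?_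
      refine (sum_shift (2 ^ n) (fun y => G y z) (hGy z) (2 ^ k)).symm.trans ?_
      rw [Finset.mul_sum]
      refine Finset.sum_congr rfl fun y _ => ?_
      simp only [hG]
      rw [show ((2 ^ k : ℕ) : ℤ) = 2 ^ k by push_cast; rfl, pk_anti]
      rw [show -(((u : ℝ) * (((y : ℤ) + 2 ^ k : ℤ) : ℝ) + v * ((z : ℤ) : ℝ)) / ((2 ^ n : ℕ) : ℝ)) =
        -(u * 2 ^ k / (2 ^ n : ℕ)) + -((u * ((y : ℤ) : ℝ) + v * ((z : ℤ) : ℝ)) / (2 ^ n : ℕ)) by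
          push_cast; ring, ex_add]
      push_cast; ring
    have h2 : ex (-(u * 2 ^ k / (2 ^ n : ℕ))) = -1 := by
      have h3 : (1 + ex (-(u * 2 ^ k / (2 ^ n : ℕ)))) * phat n k a u v = 0 := by
        linear_combination h1
      rcases mul_eq_zero.1 h3 with h4 | h4
      · linear_combination h4
      · exact absurd h4 h
    have h3 : ex (-(u * 2 ^ k / (2 ^ n : ℕ)) + -(u * 2 ^ k / (2 ^ n : ℕ))) = 1 := by
      rw [ex_add, h2]; norm_num
    obtain ⟨q, hq⟩ := ex_eq_one h3
    have h4 : -(u : ℝ) * 2 ^ (k + 1) = q * (2 ^ n : ℕ) := by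
      rw [← hq, pow_succ]; field_simp; ring
    have h5 : -u * 2 ^ (k + 1) = q * 2 ^ n := by exact_mod_cast h4
    rcases Int.even_or_odd q with ⟨j, hj⟩ | ⟨j, hj⟩
    · exfalso
      have : -((u : ℝ) * 2 ^ k / (2 ^ n : ℕ)) = ((j : ℤ) : ℝ) := by
        rw [hj] at hq; push_cast at hq ⊢; linarith
      rw [this, ex_int] at h2
      norm_num at h2
    · refine ⟨-j - 1, ?_⟩
      rw [hj] at h5
      linear_combination -h5
  · have h1 : phat n k a u v = ex (-((2 * a * u + v : ℤ) / (2 ^ n : ℕ))) * phat n k a u v := by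
      conv_lhs => rw [hp]
      rw [hp]
      refine (sum_shift (2 ^ n) (fun z => ∑ y ∈ Finset.range (2 ^ n), G y z)
        (fun z => Finset.sum_congr rfl fun y _ => hGz _ z) 1).symm.trans ?_
      rw [Finset.mul_sum]
      refine Finset.sum_congr rfl fun z _ => ?_
      refine (sum_shift (2 ^ n) (fun y => G y (z + (1 : ℕ))) (hGy _) (2 * a)).symm.trans ?_
      rw [Finset.mul_sum]
      refine Finset.sum_congr rfl fun y _ => ?_
      simp only [hG]
      rw [show ((2 * a : ℕ) : ℤ) = 2 * a by push_cast; rfl, Nat.cast_one, pk_shift]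
      rw [show -(((u : ℝ) * (((y : ℤ) + 2 * a : ℤ) : ℝ) + v * (((z : ℤ) + 1 : ℤ) : ℝ)) /
          ((2 ^ n : ℕ) : ℝ)) = -((2 * a * u + v : ℤ) / (2 ^ n : ℕ)) +
          -((u * ((y : ℤ) : ℝ) + v * ((z : ℤ) : ℝ)) / (2 ^ n : ℕ)) by
          push_cast; ring, ex_add]
      ring
    have h2 : ex (-((2 * a * u + v : ℤ) / (2 ^ n : ℕ))) = 1 := by
      have h3 : (1 - ex (-((2 * a * u + v : ℤ) / (2 ^ n : ℕ)))) * phat n k a u v = 0 := by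
        linear_combination h1
      rcases mul_eq_zero.1 h3 with h4 | h4
      · linear_combination -h4
      · exact absurd h4 h
    obtain ⟨q, hq⟩ := ex_eq_one h2
    have h4 : ((2 * a * u + v : ℤ) : ℝ) = -q * (2 ^ n : ℕ) := by
      rw [← hq]; field_simp
    have h5 : 2 * a * u + v = -q * 2 ^ n := by exact_mod_cast h4
    exact ⟨-q, by rw [h5]; ring⟩

lemma level_le {n k k' : ℕ} {u : ℤ} {j j' : ℤ} (h : 2 ^ (k + 1) * u = 2 ^ n * (2 * j + 1))
    (h' : 2 ^ (k' + 1) * u = 2 ^ n * (2 * j' + 1)) : k' ≤ k := by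
  by_contra hlt
  push Not at hlt
  obtain ⟨d, rfl⟩ := Nat.exists_eq_add_of_lt hlt
  have h0 : (2 ^ n : ℤ) ≠ 0 := by positivity
  have h2 : 2 * j' + 1 = 2 * (2 ^ d * (2 * j + 1)) := by
    apply mul_left_cancel₀ h0
    rw [← h']
    have : (2 : ℤ) ^ (k + d + 1 + 1) * u = 2 ^ (d + 1) * (2 ^ (k + 1) * u) := by ring
    rw [this, h]; ring
  omega

lemma phat_disj {n k a k' a' : ℕ} {u v : ℤ} (hk : k < n) (hk' : k' < n) (ha : a < 2 ^ k)
    (ha' : a' < 2 ^ k') (h : phat n k a u v ≠ 0) (h' : phat n k' a' u v ≠ 0) : k = k' ∧ a = a' := by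
  obtain ⟨⟨j, hj⟩, h1⟩ := phat_ne hk h
  obtain ⟨⟨j', hj'⟩, h1'⟩ := phat_ne hk' h'
  have hkk : k = k' := le_antisymm (level_le hj' hj) (level_le hj hj')
  subst hkk
  refine ⟨rfl, ?_⟩
  have h2 : (2 ^ n : ℤ) ∣ 2 * ((a : ℤ) - a') * u := by
    have := dvd_sub h1 h1'
    rwa [show 2 * (a : ℤ) * u + v - (2 * a' * u + v) = 2 * ((a : ℤ) - a') * u by ring] at this
  have h0 : (2 ^ n : ℤ) ≠ 0 := by positivity
  have h3 : (2 ^ n : ℤ) * 2 ^ k ∣ 2 ^ n * (((a : ℤ) - a') * (2 * j + 1)) := by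
    have := mul_dvd_mul_right h2 (2 ^ k)
    rwa [show 2 * ((a : ℤ) - a') * u * 2 ^ k = ((a : ℤ) - a') * (2 ^ (k + 1) * u) by ring, hj,
      show ((a : ℤ) - a') * (2 ^ n * (2 * j + 1)) = 2 ^ n * (((a : ℤ) - a') * (2 * j + 1)) by ring]
      at this
  have h4 := (mul_dvd_mul_iff_left h0).1 h3
  have hc : IsCoprime (2 ^ k : ℤ) (2 * j + 1) := IsCoprime.pow_left ⟨-j, 1, by ring⟩
  have h5 := hc.dvd_of_dvd_mul_right h4
  have hA : (a : ℤ) < 2 ^ k := by exact_mod_cast ha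
  have hA' : (a' : ℤ) < 2 ^ k := by exact_mod_cast ha'
  have h6 := Int.eq_zero_of_abs_lt_dvd h5 (by rw [abs_lt]; constructor <;> omega)
  omega

def bt (A i : ℕ) : ℕ := A / 2 ^ i % 2

lemma bt_cases (A i : ℕ) : bt A i = 0 ∨ bt A i = 1 := by unfold bt; omega

lemma bt_mod (A k i : ℕ) (h : i < k) : bt (A % 2 ^ k) i = bt A i := by
  have h1 := Nat.testBit_mod_two_pow A k i
  simp only [h, decide_true, Bool.true_and, Nat.testBit_eq_decide_div_mod_eq, decide_eq_decide] at h1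
  unfold bt; omega

lemma pk_eval {n k a A : ℕ} {y z : ℤ} (hk' : k < n) (ha : a < 2 ^ k)
    (hA : (2 ^ n : ℤ) ∣ y - A * (1 + 2 * z)) :
    pk k a y z = if a = A % 2 ^ k then (if bt A k = 1 then -1 else 1) else 0 := by
  have hd : ∀ j, j ≤ n → ((2 ^ j : ℤ) ∣ y - a * (1 + 2 * z) ↔ (2 ^ j : ℤ) ∣ (A : ℤ) - a) := by
    intro j hj
    have h1 : (2 ^ j : ℤ) ∣ y - A * (1 + 2 * z) := (pow_dvd_pow 2 hj).trans hA
    rw [show y - a * (1 + 2 * z) = ((A : ℤ) - a) * (1 + 2 * z) + (y - A * (1 + 2 * z)) by ring,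
      Int.dvd_add_left h1]
    have hc : IsCoprime (2 ^ j : ℤ) (1 + 2 * z) := IsCoprime.pow_left ⟨-z, 1, by ring⟩
    exact ⟨fun h => hc.dvd_of_dvd_mul_right h, fun h => h.mul_right _⟩
  unfold pk hk
  simp only [hd _ hk', hd _ hk'.le]
  have hdm := Nat.div_add_mod A (2 ^ k)
  by_cases h : a = A % 2 ^ k
  · have e : (A : ℤ) - a = 2 ^ k * ((A / 2 ^ k : ℕ) : ℤ) := by
      have : (A : ℤ) = 2 ^ k * ((A / 2 ^ k : ℕ) : ℤ) + a := by rw [h]; exact_mod_cast hdm.symm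
      linarith
    rw [if_pos h, e]
    have e1 : (2 ^ (k + 1) : ℤ) ∣ 2 ^ k * ((A / 2 ^ k : ℕ) : ℤ) ↔ (2 : ℤ) ∣ ((A / 2 ^ k : ℕ) : ℤ) := by
      rw [pow_succ]; exact mul_dvd_mul_iff_left (by positivity)
    simp only [e1, dvd_mul_right, if_true]
    by_cases hb : bt A k = 1
    · have : ¬ (2 : ℤ) ∣ ((A / 2 ^ k : ℕ) : ℤ) := by unfold bt at hb; omega
      rw [if_neg this, if_pos hb]
    · have : (2 : ℤ) ∣ ((A / 2 ^ k : ℕ) : ℤ) := by unfold bt at hb; omega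
      rw [if_pos this, if_neg hb]
  · have h1 : ¬ (2 ^ k : ℤ) ∣ (A : ℤ) - a := by
      intro hdv
      apply h
      have h2 : (a : ℤ) ≡ A [ZMOD ((2 ^ k : ℕ) : ℤ)] := (Int.modEq_iff_dvd).2 (by exact_mod_cast hdv)
      have h3 : a ≡ A [MOD 2 ^ k] := Int.natCast_modEq_iff.1 h2
      rw [← h3, Nat.mod_eq_of_lt ha]
    have h2 : ¬ (2 ^ (k + 1) : ℤ) ∣ (A : ℤ) - a :=
      fun h' => h1 ((pow_dvd_pow 2 (Nat.le_succ k)).trans h')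
    rw [if_neg h, if_neg h1, if_neg h2]

lemma exists_A (n : ℕ) (y z : ℤ) : ∃ A : ℕ, (2 ^ n : ℤ) ∣ y - A * (1 + 2 * z) := by
  have hc : IsCoprime (2 ^ n : ℤ) (1 + 2 * z) := IsCoprime.pow_left ⟨-z, 1, by ring⟩
  obtain ⟨p, q, hpq⟩ := hc
  have hpos : (0 : ℤ) < 2 ^ n := by positivity
  refine ⟨((y * q) % 2 ^ n).toNat, ?_⟩
  rw [Int.toNat_of_nonneg (Int.emod_nonneg _ hpos.ne')]
  have := Int.emod_add_mul_ediv (y * q) (2 ^ n)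
  have e : (y * q) % 2 ^ n = y * q - 2 ^ n * (y * q / 2 ^ n) := by linarith
  rw [e]
  refine ⟨y * p + (y * q / 2 ^ n) * (1 + 2 * z), ?_⟩
  linear_combination -y * hpq

def bet (n k A : ℕ) : ℕ := ∑ i ∈ Finset.range k, bt A i * 2 ^ (n - i)

def rho (n : ℕ) (I : Σ _ : ℕ, ℕ) : ℕ := bet n I.1 I.2 + 2 ^ (n - I.1)

lemma bet_mod (n k A : ℕ) : bet n k (A % 2 ^ k) = bet n k A := by
  unfold bet
  refine Finset.sum_congr rfl fun i hi => ?_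
  rw [bt_mod _ _ _ (Finset.mem_range.1 hi)]

lemma bet_succ (n k A : ℕ) : bet n (k + 1) A = bet n k A + bt A k * 2 ^ (n - k) := by
  unfold bet; rw [Finset.sum_range_succ]

lemma bet_mono (n A : ℕ) : Monotone (fun k => bet n k A) :=
  monotone_nat_of_le_succ fun k => by simp only [bet_succ]; omega

lemma bet_upper (n A : ℕ) (d : ℕ) : ∀ k, k + d = n → bet n n A + 2 ≤ bet n k A + 2 ^ (d + 1) := by
  induction d with
  | zero => intro k hk; have : k = n := by omega
            subst this; simp
  | succ d ih =>
    intro k hk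
    have h1 := ih (k + 1) (by omega)
    rw [bet_succ, show n - k = d + 1 by omega] at h1
    have h2 := pow_succ 2 (d + 1)
    rcases bt_cases A k with h | h <;> rw [h] at h1 <;> omega

lemma rho_iff (n k A : ℕ) (hk : k < n) : rho n ⟨k, A % 2 ^ k⟩ ≤ bet n n A + 1 ↔ bt A k = 1 := by
  simp only [rho, bet_mod]
  have h1 := bet_upper n A (n - (k + 1)) (k + 1) (by omega)
  rw [bet_succ, show n - (k + 1) + 1 = n - k by omega] at h1
  have h2 : bet n (k + 1) A ≤ bet n n A := bet_mono n A (show k + 1 ≤ n by omega)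
  rw [bet_succ] at h2
  rcases bt_cases A k with h | h <;> rw [h] at h1 h2 ⊢ <;> constructor <;> intro h3 <;> omega

def Jn (n : ℕ) : Finset (Σ _ : ℕ, ℕ) := (Finset.range n).sigma fun k => Finset.range (2 ^ k)

noncomputable def Sp (n t : ℕ) (y z : ℤ) : ℝ := ∑ I ∈ Jn n with rho n I ≤ t, pk I.1 I.2 y z

lemma Sp_eval {n t A : ℕ} {y z : ℤ} (hA : (2 ^ n : ℤ) ∣ y - A * (1 + 2 * z)) :
    Sp n t y z = ∑ k ∈ Finset.range n, if rho n ⟨k, A % 2 ^ k⟩ ≤ t then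
      (if bt A k = 1 then (-1 : ℝ) else 1) else 0 := by
  unfold Sp Jn
  rw [Finset.sum_filter, Finset.sum_sigma]
  refine Finset.sum_congr rfl fun k hk => ?_
  have hk' := Finset.mem_range.1 hk
  have h : ∀ a ∈ Finset.range (2 ^ k), (if rho n ⟨k, a⟩ ≤ t then pk k a y z else 0) =
      if a = A % 2 ^ k then (if rho n ⟨k, A % 2 ^ k⟩ ≤ t then
      (if bt A k = 1 then (-1 : ℝ) else 1) else 0) else 0 := by
    intro a ha
    rw [pk_eval hk' (Finset.mem_range.1 ha) hA]
    by_cases h : a = A % 2 ^ k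
    · rw [← h]; simp
    · simp [h]
  rw [Finset.sum_congr rfl h, Finset.sum_ite_eq', if_pos]
  exact Finset.mem_range.2 (Nat.mod_lt _ (by positivity))

lemma Sp_abs (n t : ℕ) (y z : ℤ) : |Sp n t y z| ≤ n := by
  obtain ⟨A, hA⟩ := exists_A n y z
  rw [Sp_eval hA]
  refine (Finset.abs_sum_le_sum_abs _ _).trans ?_
  have : ∀ k ∈ Finset.range n, |if rho n ⟨k, A % 2 ^ k⟩ ≤ t then
      (if bt A k = 1 then (-1 : ℝ) else 1) else 0| ≤ 1 := by
    intro k _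
    split_ifs <;> simp
  refine (Finset.sum_le_sum this).trans ?_
  simp

def Tn (n : ℕ) : ℕ := (Jn n).sup (rho n)

lemma Sp_big (n : ℕ) (y z : ℤ) : ∃ t, (n : ℝ) / 3 ≤ |Sp n t y z| := by
  obtain ⟨A, hA⟩ := exists_A n y z
  have h1 : Sp n (bet n n A + 1) y z = - ∑ k ∈ Finset.range n, (bt A k : ℝ) := by
    rw [Sp_eval hA, ← Finset.sum_neg_distrib]
    refine Finset.sum_congr rfl fun k hk => ?_
    rw [if_congr (rho_iff n k A (Finset.mem_range.1 hk)) rfl rfl]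
    rcases bt_cases A k with h | h <;> simp [h]
  have h2 : Sp n (Tn n) y z = n - 2 * ∑ k ∈ Finset.range n, (bt A k : ℝ) := by
    have : (n : ℝ) = ∑ k ∈ Finset.range n, (1 : ℝ) := by simp
    rw [Sp_eval hA, this, Finset.mul_sum, ← Finset.sum_sub_distrib]
    refine Finset.sum_congr rfl fun k hk => ?_
    have hm : (⟨k, A % 2 ^ k⟩ : Σ _ : ℕ, ℕ) ∈ Jn n := by
      simp only [Jn, Finset.mem_sigma]
      exact ⟨hk, Finset.mem_range.2 (Nat.mod_lt _ (by positivity))⟩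
    rw [if_pos (show rho n ⟨k, A % 2 ^ k⟩ ≤ Tn n from Finset.le_sup (f := rho n) hm)]
    rcases bt_cases A k with h | h <;> simp [h]
    norm_num
  set r := ∑ k ∈ Finset.range n, (bt A k : ℝ)
  by_cases h : (n : ℝ) / 3 ≤ r
  · refine ⟨bet n n A + 1, ?_⟩
    rw [h1, abs_neg]
    exact h.trans (le_abs_self _)
  · push Not at h
    refine ⟨Tn n, ?_⟩
    rw [h2]
    refine le_trans ?_ (le_abs_self _)
    linarith

noncomputable def Gk (k : ℕ) (y z : ℤ) : ℝ := ∑ a ∈ Finset.range (2 ^ k), pk k a y z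

lemma Gk_sq (k : ℕ) (y z : ℤ) : Gk k y z * Gk k y z ≤ 1 := by
  obtain ⟨A, hA⟩ := exists_A (k + 1) y z
  have : Gk k y z = if bt A k = 1 then (-1 : ℝ) else 1 := by
    unfold Gk
    rw [Finset.sum_congr rfl fun a ha => pk_eval (Nat.lt_succ_self k) (Finset.mem_range.1 ha) hA,
      Finset.sum_ite_eq', if_pos]
    exact Finset.mem_range.2 (Nat.mod_lt _ (by positivity))
  rw [this]; split_ifs <;> norm_num

lemma Gk_orth {n k l : ℕ} (hkl : k < l) (hl : l < n) (z : ℤ) :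
    ∑ y ∈ Finset.range (2 ^ n), Gk k y z * Gk l y z = 0 := by
  have hper : ∀ j, j < n → ∀ y, Gk j (y + (2 ^ n : ℕ)) z = Gk j y z := by
    intro j hj y
    refine Finset.sum_congr rfl fun a _ => pk_period _ _ _ _ _ ?_
    push_cast; exact pow_dvd_pow 2 hj
  have h := sum_shift (2 ^ n) (fun y => Gk k y z * Gk l y z)
    (fun y => by simp only [hper k (hkl.trans hl), hper l hl]) (2 ^ l)
  have h2 : ∀ y ∈ Finset.range (2 ^ n), Gk k ((y : ℤ) + (2 ^ l : ℕ)) z * Gk l ((y : ℤ) + (2 ^ l : ℕ)) z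
      = -(Gk k y z * Gk l y z) := by
    intro y _
    have e1 : Gk k ((y : ℤ) + (2 ^ l : ℕ)) z = Gk k y z := by
      refine Finset.sum_congr rfl fun a _ => pk_period _ _ _ _ _ ?_
      push_cast; exact pow_dvd_pow 2 hkl
    have e2 : Gk l ((y : ℤ) + (2 ^ l : ℕ)) z = - Gk l y z := by
      unfold Gk
      rw [← Finset.sum_neg_distrib]
      refine Finset.sum_congr rfl fun a _ => ?_
      rw [← pk_anti]; push_cast; rfl
    rw [e1, e2]; ring
  rw [Finset.sum_congr rfl h2, Finset.sum_neg_distrib] at h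
  linarith

lemma g_l2 (n : ℕ) : ∑ y ∈ Finset.range (2 ^ n), ∑ z ∈ Finset.range (2 ^ n),
    (∑ I ∈ Jn n, pk I.1 I.2 y z) ^ 2 ≤ n * ((2 ^ n : ℕ) : ℝ) ^ 2 := by
  have e : ∀ y z : ℤ, ∑ I ∈ Jn n, pk I.1 I.2 y z = ∑ k ∈ Finset.range n, Gk k y z := by
    intro y z; rw [Jn, Finset.sum_sigma]; rfl
  simp only [e]
  rw [Finset.sum_comm]
  have h : ∀ z ∈ Finset.range (2 ^ n), ∑ y ∈ Finset.range (2 ^ n),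
      (∑ k ∈ Finset.range n, Gk k y z) ^ 2 ≤ n * ((2 ^ n : ℕ) : ℝ) := by
    intro z _
    simp only [sq, Finset.sum_mul_sum]
    rw [Finset.sum_comm]
    have h2 : ∀ k ∈ Finset.range n, ∑ y ∈ Finset.range (2 ^ n), ∑ l ∈ Finset.range n,
        Gk k y z * Gk l y z ≤ ((2 ^ n : ℕ) : ℝ) := by
      intro k hk
      rw [Finset.sum_comm]
      rw [Finset.sum_eq_single k]
      · refine (Finset.sum_le_sum fun (y : ℕ) _ => Gk_sq k (y : ℤ) z).trans ?_
        simp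
      · intro l hl hlk
        have hk' := Finset.mem_range.1 hk
        have hl' := Finset.mem_range.1 hl
        rcases lt_or_gt_of_ne hlk with h | h
        · rw [← Gk_orth h hk' z]
          exact Finset.sum_congr rfl fun y _ => mul_comm _ _
        · exact Gk_orth h hl' z
      · intro h; exact absurd hk h
    refine (Finset.sum_le_sum h2).trans ?_
    simp
  refine (Finset.sum_le_sum h).trans ?_
  simp only [Finset.sum_const, Finset.card_range, nsmul_eq_mul]
  apply le_of_eq; ring

lemma meas_lower (n : ℕ) (E : Set ℝ) (hE : E ⊆ Set.Ioc (0:ℝ) 1)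
    (h : ∀ j < 2 ^ n, ∀ i < 2 ^ n, ∀ x ∈ Set.Ioc
      (((j * (256 * 2 ^ n) + i : ℕ) : ℝ) / (2 ^ n * (256 * 2 ^ n)))
      ((((j * (256 * 2 ^ n) + i : ℕ) : ℝ) + 1 / 256) / (2 ^ n * (256 * 2 ^ n))), x ∈ E) :
    (1 / 65536 : ℝ) ≤ (volume E).toReal := by
  classical
  set Q : ℕ := 2 ^ n with hQ
  have hQ0 : 0 < Q := by positivity
  have hQr : ((2 : ℝ) ^ n) = Q := by rw [hQ]; push_cast; rfl
  rw [hQr] at h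
  have hQpos : (0 : ℝ) < Q := by exact_mod_cast hQ0
  set M : ℝ := Q * (256 * Q) with hM
  have hMpos : 0 < M := by positivity
  let L : Finset ℕ := (Finset.range Q ×ˢ Finset.range Q).image fun p => p.1 * (256 * Q) + p.2
  have hcard : L.card = Q * Q := by
    rw [Finset.card_image_of_injOn, Finset.card_product, Finset.card_range]
    intro p hp q hq hpq
    simp only [Finset.coe_product, Finset.coe_range, Set.mem_prod, Set.mem_Iio] at hp hq
    have hpq : p.1 * (256 * Q) + p.2 = q.1 * (256 * Q) + q.2 := hpq
    have h256 : 0 < 256 * Q := by omega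
    have e1 : p.1 = q.1 := by
      have : (p.1 * (256 * Q) + p.2) / (256 * Q) = (q.1 * (256 * Q) + q.2) / (256 * Q) := by
        rw [hpq]
      rw [mul_comm p.1, mul_comm q.1, Nat.mul_add_div h256, Nat.mul_add_div h256,
        Nat.div_eq_of_lt (by omega), Nat.div_eq_of_lt (by omega)] at this
      omega
    rw [e1] at hpq
    exact Prod.ext e1 (by omega)
  let U : ℕ → Set ℝ := fun l => Set.Ioc ((l : ℝ) / M) (((l : ℝ) + 1 / 256) / M)
  have hsub : (⋃ l ∈ L, U l) ⊆ E := by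
    intro x hx
    simp only [Set.mem_iUnion] at hx
    obtain ⟨l, hl, hx⟩ := hx
    obtain ⟨p, hp, rfl⟩ := Finset.mem_image.1 hl
    rw [Finset.mem_product, Finset.mem_range, Finset.mem_range] at hp
    exact h p.1 hp.1 p.2 hp.2 x hx
  have haux : ∀ l l' : ℕ, l < l' → Disjoint (U l) (U l') := by
    intro l l' hll
    rw [Set.disjoint_left]
    intro x hx hx'
    have h1 := hx.2
    have h2 := hx'.1
    have h3 : ((l : ℝ) + 1 / 256) / M ≤ (l' : ℝ) / M := by
      have : (l : ℝ) + 1 ≤ l' := by exact_mod_cast hll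
      gcongr; linarith
    linarith
  have hdisj : (L : Set ℕ).PairwiseDisjoint U := by
    intro l _ l' _ hne
    rcases lt_or_gt_of_ne hne with h | h
    · exact haux _ _ h
    · exact (haux _ _ h).symm
  have hvol : volume (⋃ l ∈ L, U l) = ENNReal.ofReal (1 / 65536) := by
    rw [measure_biUnion_finset hdisj (fun l _ => measurableSet_Ioc)]
    have : ∀ l ∈ L, volume (U l) = ENNReal.ofReal (1 / 256 / M) := by
      intro l _
      simp only [U, Real.volume_Ioc]
      congr 1; ring
    rw [Finset.sum_congr rfl this, Finset.sum_const, hcard, nsmul_eq_mul,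
      ← ENNReal.ofReal_natCast, ← ENNReal.ofReal_mul (by positivity)]
    congr 1
    rw [hM]; push_cast; field_simp; norm_num
  have hfin : volume E ≠ ⊤ := by
    refine ne_top_of_le_ne_top ?_ (measure_mono hE)
    simp
  rw [← ENNReal.ofReal_le_iff_le_toReal hfin, ← hvol]
  exact measure_mono hsub

lemma W_big (n j i : ℕ) (hi : i < 2 ^ n) (x : ℝ)
    (hx : x ∈ Set.Ioc (((j * (256 * 2 ^ n) + i : ℕ) : ℝ) / (2 ^ n * (256 * 2 ^ n)))
      ((((j * (256 * 2 ^ n) + i : ℕ) : ℝ) + 1 / 256) / (2 ^ n * (256 * 2 ^ n)))) :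
    (9 / 10 : ℝ) ≤ W (2 ^ n) (256 * 2 ^ n) j ((j * (256 * 2 ^ n) + i) % 2 ^ n) x := by
  set Q : ℕ := 2 ^ n with hQ
  have hQ0 : 0 < Q := by positivity
  have hQr : ((2 : ℝ) ^ n) = Q := by rw [hQ]; push_cast; rfl
  rw [hQr] at hx
  have hQpos : (0 : ℝ) < Q := by exact_mod_cast hQ0
  set l : ℕ := j * (256 * Q) + i with hl
  have hlr : (l : ℝ) = j * (256 * Q) + i := by rw [hl]; push_cast; ring
  have hx1 := (div_lt_iff₀ (by positivity)).1 hx.1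
  have hx2 := (le_div_iff₀ (by positivity)).1 hx.2
  have hir : (i : ℝ) + 1 ≤ Q := by exact_mod_cast hi
  have hi0 : (0 : ℝ) ≤ i := by positivity
  have hpi := Real.pi_lt_d2
  have hpi0 := Real.pi_pos
  have a1 : |x - j / Q| ≤ (1 / 256) / Q := by
    have e : x - j / Q = (x * (Q * (256 * Q)) - j * (256 * Q)) / (Q * (256 * Q)) := by field_simp
    rw [e, abs_of_nonneg (div_nonneg (by linarith) (by positivity)),
      div_le_div_iff₀ (by positivity) hQpos]
    have : x * (Q * (256 * Q)) - j * (256 * Q) ≤ Q := by linarith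
    nlinarith
  have a2 : |(256 * Q : ℕ) * x - l / Q| ≤ (1 / 256) / Q := by
    have e : ((256 * Q : ℕ) : ℝ) * x - l / Q = (x * (Q * (256 * Q)) - l) / Q := by
      push_cast; field_simp
    rw [e, abs_of_nonneg (div_nonneg (by linarith) (by positivity))]
    gcongr; linarith
  have f1 := Fj_lower Q hQ0 _ (1 / 256) a1 (by linarith)
  have f2 := Fj_lower Q hQ0 _ (1 / 256) a2 (by linarith)
  have f3 : Fj Q ((256 * Q : ℕ) * x - ((l % Q : ℕ) : ℝ) / Q) = Fj Q ((256 * Q : ℕ) * x - l / Q) := by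
    rw [← Fj_periodic Q ((256 * Q : ℕ) * x - l / Q) ((l / Q : ℕ) : ℤ)]
    congr 1
    have : (l : ℝ) = Q * ((l / Q : ℕ) : ℝ) + ((l % Q : ℕ) : ℝ) := by
      exact_mod_cast (Nat.div_add_mod l Q).symm
    rw [Int.cast_natCast, this]
    field_simp; ring
  unfold W
  rw [f3]
  have g1 : (95 / 100 : ℝ) ≤ Fj Q (x - j / Q) := by linarith
  have g2 : (95 / 100 : ℝ) ≤ Fj Q ((256 * Q : ℕ) * x - l / Q) := by linarith
  nlinarith

lemma weighted_lower {α : Type*} [DecidableEq α] (s : Finset α) (S w : α → ℝ) (n : ℝ) (p : α) (hp : p ∈ s)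
    (hw : ∀ a ∈ s, 0 ≤ w a) (hsum : ∑ a ∈ s, w a = 1) (hS : ∀ a ∈ s, |S a| ≤ n)
    (h1 : 9 / 10 ≤ w p) (h2 : n / 3 ≤ |S p|) (hn : 0 < n) : n / 6 < |∑ a ∈ s, S a * w a| := by
  have e1 := Finset.add_sum_erase s (fun a => S a * w a) hp
  have e2 := Finset.add_sum_erase s w hp
  have h3 : |∑ a ∈ s.erase p, S a * w a| ≤ n * ∑ a ∈ s.erase p, w a := by
    refine (Finset.abs_sum_le_sum_abs _ _).trans ?_
    rw [Finset.mul_sum]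
    refine Finset.sum_le_sum fun a ha => ?_
    have ha' := Finset.mem_of_mem_erase ha
    rw [abs_mul, abs_of_nonneg (hw a ha')]
    exact mul_le_mul_of_nonneg_right (hS a ha') (hw a ha')
  rw [← e1]
  have h4 := abs_sub_abs_le_abs_sub (S p * w p) (-∑ a ∈ s.erase p, S a * w a)
  rw [abs_neg, sub_neg_eq_add, abs_mul, abs_of_nonneg (hw p hp)] at h4
  have h5 : ∑ a ∈ s.erase p, w a ≤ 1 / 10 := by linarith
  have h6 : n * ∑ a ∈ s.erase p, w a ≤ n * (1 / 10) := by gcongr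
  have h7 : n / 3 * (9 / 10) ≤ |S p| * w p := by gcongr
  linarith

lemma P_expand (n R k a : ℕ) (K : ℤ) (x : ℝ) :
    ∑ b ∈ Bq (2 ^ n), (1 / (2 ^ n : ℕ) : ℂ) ^ 4 * phat n k a (m1 b) (m2 b) *
      ex ((K + (m1 b + R * m2 b) : ℤ) * x) =
    ex (K * x) * ((∑ p ∈ Finset.range (2 ^ n) ×ˢ Finset.range (2 ^ n),
      pk k a p.1 p.2 * W (2 ^ n) R p.1 p.2 x : ℝ) : ℂ) := by
  push_cast [W_expand]
  simp only [phat, ← Finset.sum_product']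
  simp only [Finset.mul_sum, Finset.sum_mul]
  rw [Finset.sum_comm]
  refine Finset.sum_congr rfl fun p _ => Finset.sum_congr rfl fun b _ => ?_
  rw [show ((K : ℝ) + ((m1 b : ℝ) + R * (m2 b : ℝ))) * x =
    K * x + ((m1 b : ℝ) + R * (m2 b : ℝ)) * x by ring, ex_add]
  push_cast; ring

lemma main_case (n N : ℕ) (hn : 1 ≤ n) (hN : 512 * 4 ^ n ≤ N) :
    ∃ σ : ℕ → ℕ, Set.BijOn σ (Set.Icc 1 N) (Set.Icc 1 N) ∧
      ∃ f : ℝ → ℂ, MemLp f 2 (volume.restrict (Set.Ioc (0:ℝ) 1)) ∧ l2normT f ≤ 1 ∧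
        (1 / 65536 : ℝ) ≤ (volume {x ∈ Set.Ioc (0:ℝ) 1 | Real.sqrt n / 6 < Tmax N σ f x}).toReal := by
  classical
  have hnr : (0 : ℝ) < n := by exact_mod_cast hn
  set Q : ℕ := 2 ^ n with hQ
  have hQ0 : 0 < Q := by positivity
  have hQr : (0 : ℝ) < Q := by exact_mod_cast hQ0
  set R : ℕ := 256 * Q with hR
  set K : ℤ := R * Q with hK
  have hQQ : 512 * 4 ^ n = 2 * (R * Q) := by
    rw [hR, hQ, show (4 : ℕ) = 2 ^ 2 by norm_num, ← pow_mul]; ring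
  let fr : (ℕ × ℕ) × (ℕ × ℕ) → ℤ := fun b => K + (m1 b + R * m2 b)
  let s : ℝ := 1 / Real.sqrt n
  have hs : 0 < s := by positivity
  let c : (Σ _ : ℕ, ℕ) → (ℕ × ℕ) × (ℕ × ℕ) → ℂ := fun I b =>
    (s : ℂ) * ((1 / (2 ^ n : ℕ) : ℂ) ^ 4 * phat n I.1 I.2 (m1 b) (m2 b))
  have hfr : ∀ b ∈ Bq Q, 1 ≤ fr b ∧ fr b ≤ N := by
    intro b hb
    obtain ⟨h1, h2⟩ := m_bound hb
    rw [abs_lt] at h1 h2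
    have hN' : (2 * (R * Q) : ℤ) ≤ N := by rw [hQQ] at hN; exact_mod_cast hN
    have hRQ : (Q : ℤ) ≤ R := by rw [hR]; push_cast; omega
    have hR0 : (0 : ℤ) ≤ R := by positivity
    have u1 : (R : ℤ) * m2 b ≤ R * (Q - 1) := mul_le_mul_of_nonneg_left (by omega) hR0
    have u2 : (R : ℤ) * (-(Q - 1)) ≤ R * m2 b := mul_le_mul_of_nonneg_left (by omega) hR0
    simp only [fr, hK]
    constructor <;> nlinarith
  have hinj : ∀ b ∈ Bq Q, ∀ b' ∈ Bq Q, fr b = fr b' → m1 b = m1 b' ∧ m2 b = m2 b' := by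
    intro b hb b' hb' he
    obtain ⟨h1, h2⟩ := m_bound hb
    obtain ⟨h1', h2'⟩ := m_bound hb'
    rw [abs_lt] at h1 h1'
    simp only [fr] at he
    have hd : (R : ℤ) ∣ m1 b - m1 b' := ⟨m2 b' - m2 b, by linarith⟩
    have h3 := Int.eq_zero_of_abs_lt_dvd hd (by rw [abs_lt, hR]; push_cast; omega)
    have h4 : (R : ℤ) * m2 b = R * m2 b' := by linarith
    exact ⟨by omega, mul_left_cancel₀ (by rw [hR]; push_cast; omega) h4⟩
  obtain ⟨σ, hσ, hT⟩ := transfer (Jn n) (Bq Q) fr c (rho n) N hfr (by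
    intro I hI I' hI' b hb b' hb' he hc hc'
    obtain ⟨e1, e2⟩ := hinj b hb b' hb' he
    have n1 : phat n I.1 I.2 (m1 b) (m2 b) ≠ 0 := by
      intro h; apply hc; simp [c, h]
    have n2 : phat n I'.1 I'.2 (m1 b) (m2 b) ≠ 0 := by
      intro h; apply hc'; rw [e1, e2] at h; simp [c, h]
    simp only [Jn, Finset.mem_sigma, Finset.mem_range] at hI hI'
    obtain ⟨q1, q2⟩ := phat_disj hI.1 hI'.1 hI.2 hI'.2 n1 n2
    cases I; cases I'
    simp only at q1 q2
    rw [q1, q2])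
  have hP : ∀ I x, ∑ b ∈ Bq Q, c I b * ex (fr b * x) =
      ((s : ℂ) * ex (K * x)) * ((∑ p ∈ Finset.range Q ×ˢ Finset.range Q,
      pk I.1 I.2 p.1 p.2 * W Q R p.1 p.2 x : ℝ) : ℂ) := by
    intro I x
    rw [mul_assoc, ← P_expand n R I.1 I.2 K x, Finset.mul_sum]
    refine Finset.sum_congr rfl fun b _ => ?_
    simp only [c, fr]; ring
  have hsumP : ∀ (J : Finset (Σ _ : ℕ, ℕ)) x, ∑ I ∈ J, ∑ b ∈ Bq Q, c I b * ex (fr b * x) =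
      ((s : ℂ) * ex (K * x)) * ((∑ p ∈ Finset.range Q ×ˢ Finset.range Q,
      (∑ I ∈ J, pk I.1 I.2 p.1 p.2) * W Q R p.1 p.2 x : ℝ) : ℂ) := by
    intro J x
    simp only [hP]
    rw [← Finset.mul_sum, ← Complex.ofReal_sum, Finset.sum_comm]
    simp only [Finset.sum_mul]
  have hnorm : ∀ (J : Finset (Σ _ : ℕ, ℕ)) x, ‖∑ I ∈ J, ∑ b ∈ Bq Q, c I b * ex (fr b * x)‖ =
      s * |∑ p ∈ Finset.range Q ×ˢ Finset.range Q,
      (∑ I ∈ J, pk I.1 I.2 p.1 p.2) * W Q R p.1 p.2 x| := by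
    intro J x
    rw [hsumP, norm_mul, norm_mul, norm_ex, Complex.norm_real, Complex.norm_real, mul_one,
      Real.norm_eq_abs, Real.norm_eq_abs, abs_of_pos hs]
  have hWsum : ∀ x, ∑ p ∈ Finset.range Q ×ˢ Finset.range Q, W Q R p.1 p.2 x = 1 := by
    intro x; rw [Finset.sum_product]; exact W_sum Q R hQ0 x
  have hcont : Continuous (fun x : ℝ => ∑ I ∈ Jn n, ∑ b ∈ Bq Q, c I b * ex (fr b * x)) := by
    have := continuous_ex
    fun_prop
  have hWc : ∀ y z, Continuous (W Q R y z) := by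
    intro y z; unfold W
    have := Fj_continuous Q
    fun_prop
  refine ⟨σ, hσ, fun x => ∑ I ∈ Jn n, ∑ b ∈ Bq Q, c I b * ex (fr b * x), ?_, ?_,
    meas_lower n _ (fun x hx => hx.1) ?_⟩
  · have h1 : MemLp (fun x : ℝ => ∑ I ∈ Jn n, ∑ b ∈ Bq Q, c I b * ex (fr b * x)) ⊤
        (volume.restrict (Set.Ioc (0:ℝ) 1)) := by
      refine memLp_top_of_bound hcont.aestronglyMeasurable (∑ I ∈ Jn n, ∑ b ∈ Bq Q, ‖c I b‖) ?_
      refine Filter.Eventually.of_forall fun x => ?_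
      refine (norm_sum_le _ _).trans (Finset.sum_le_sum fun I _ => ?_)
      refine (norm_sum_le _ _).trans (Finset.sum_le_sum fun b _ => ?_)
      rw [norm_mul, norm_ex, mul_one]
    exact h1.mono_exponent le_top
  · unfold l2normT
    have h0 : (0 : ℝ) ≤ ∫ x in (0:ℝ)..1, ‖∑ I ∈ Jn n, ∑ b ∈ Bq Q, c I b * ex (fr b * x)‖ ^ 2 :=
      intervalIntegral.integral_nonneg zero_le_one fun x _ => by positivity
    refine Real.rpow_le_one h0 ?_ (by norm_num)
    set g : ℕ × ℕ → ℝ := fun p => ∑ I ∈ Jn n, pk I.1 I.2 p.1 p.2 with hg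
    have hle : ∀ x : ℝ, ‖∑ I ∈ Jn n, ∑ b ∈ Bq Q, c I b * ex (fr b * x)‖ ^ 2 ≤
        s ^ 2 * ∑ p ∈ Finset.range Q ×ˢ Finset.range Q, g p ^ 2 * W Q R p.1 p.2 x := by
      intro x
      rw [hnorm, mul_pow, sq_abs]
      gcongr
      have := Finset.sum_sq_le_sum_mul_sum_of_sq_eq_mul (Finset.range Q ×ˢ Finset.range Q)
        (r := fun p => g p * W Q R p.1 p.2 x) (f := fun p => g p ^ 2 * W Q R p.1 p.2 x)
        (g := fun p => W Q R p.1 p.2 x)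
        (fun p _ => mul_nonneg (sq_nonneg _) (W_nonneg _ _ _ _ _)) (fun p _ => W_nonneg _ _ _ _ _)
        (fun p _ => by ring)
      rw [hWsum, mul_one] at this
      exact this
    have hc2 : Continuous (fun x => s ^ 2 * ∑ p ∈ Finset.range Q ×ˢ Finset.range Q,
        g p ^ 2 * W Q R p.1 p.2 x) := by
      refine continuous_const.mul (continuous_finset_sum _ fun p _ => continuous_const.mul (hWc _ _))
    refine (intervalIntegral.integral_mono_on zero_le_one
      (Continuous.intervalIntegrable (by fun_prop) _ _)
      (hc2.intervalIntegrable _ _) (fun x _ => hle x)).trans ?_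
    rw [intervalIntegral.integral_const_mul, intervalIntegral.integral_finsetSum]
    · simp only [intervalIntegral.integral_const_mul]
      rw [Finset.sum_congr rfl fun p _ => by rw [W_integral Q R p.1 p.2 hQ0 (by omega)]]
      rw [← Finset.sum_mul, Finset.sum_product]
      have h := g_l2 n
      rw [← hQ] at h
      have hs2 : s ^ 2 = 1 / n := by
        simp only [s, div_pow, one_pow, Real.sq_sqrt hnr.le]
      rw [hs2]
      calc 1 / (n : ℝ) * ((∑ y ∈ Finset.range Q, ∑ z ∈ Finset.range Q, g (y, z) ^ 2) * (1 / (Q : ℝ)) ^ 2)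
          ≤ 1 / (n : ℝ) * ((n * (Q : ℝ) ^ 2) * (1 / (Q : ℝ)) ^ 2) := by gcongr
        _ = 1 := by field_simp
    · intro p _
      exact (continuous_const.mul (hWc _ _)).intervalIntegrable _ _
  · intro j hj i hi x hx
    have hW := W_big n j i hi x hx
    have hxI : x ∈ Set.Ioc (0:ℝ) 1 := by
      constructor
      · exact lt_of_le_of_lt (by positivity) hx.1
      · refine hx.2.trans ?_
        rw [div_le_one (by positivity)]
        have h1 : ((j * (256 * 2 ^ n) + i + 1 : ℕ) : ℝ) ≤ ((2 ^ n * (256 * 2 ^ n) : ℕ) : ℝ) := by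
          apply Nat.cast_le.2
          have : (j + 1) * (256 * 2 ^ n) ≤ 2 ^ n * (256 * 2 ^ n) := Nat.mul_le_mul_right _ hj
          rw [add_mul] at this
          omega
        push_cast at h1 ⊢
        linarith
    refine ⟨hxI, ?_⟩
    set z0 := (j * (256 * 2 ^ n) + i) % 2 ^ n with hz0
    obtain ⟨t, ht⟩ := Sp_big n j z0
    refine lt_of_lt_of_le ?_ (hT t x)
    rw [hnorm]
    have hz : z0 < Q := Nat.mod_lt _ hQ0
    have := weighted_lower (Finset.range Q ×ˢ Finset.range Q) (fun p => Sp n t p.1 p.2)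
      (fun p => W Q R p.1 p.2 x) n (j, z0)
      (Finset.mem_product.2 ⟨Finset.mem_range.2 hj, Finset.mem_range.2 hz⟩)
      (fun p _ => W_nonneg _ _ _ _ _) (hWsum x) (fun p _ => Sp_abs _ _ _ _) hW ht hnr
    have e : Real.sqrt n / 6 = s * (n / 6) := by
      have := Real.mul_self_sqrt hnr.le
      have h0 : Real.sqrt n ≠ 0 := by positivity
      simp only [s]
      field_simp
      linarith
    rw [e]
    exact mul_lt_mul_of_pos_left this hs

lemma small_case (N : ℕ) (hN : 1 < N) :
    ∃ σ : ℕ → ℕ, Set.BijOn σ (Set.Icc 1 N) (Set.Icc 1 N) ∧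
      ∃ f : ℝ → ℂ, MemLp f 2 (volume.restrict (Set.Ioc (0:ℝ) 1)) ∧ l2normT f ≤ 1 ∧
        (volume {x ∈ Set.Ioc (0:ℝ) 1 | 1 / 2 < Tmax N σ f x}).toReal = 1 := by
  obtain ⟨σ, hσ, hT⟩ := transfer ({()} : Finset Unit) ({()} : Finset Unit) (fun _ => 1)
    (fun _ _ => 1) (fun _ => 0) N (by intro _ _; omega) (by intros; rfl)
  have hn : ∀ x : ℝ, ‖(∑ I ∈ ({()} : Finset Unit), ∑ b ∈ ({()} : Finset Unit),
      (1 : ℂ) * ex (((1 : ℤ) : ℝ) * x))‖ = 1 := by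
    intro x; simp [norm_ex]
  have hc : Continuous (fun x : ℝ => ∑ I ∈ ({()} : Finset Unit), ∑ b ∈ ({()} : Finset Unit),
      (1 : ℂ) * ex (((1 : ℤ) : ℝ) * x)) := by
    have := continuous_ex
    fun_prop
  refine ⟨σ, hσ, fun x : ℝ => ∑ I ∈ ({()} : Finset Unit), ∑ b ∈ ({()} : Finset Unit),
      (1 : ℂ) * ex (((1 : ℤ) : ℝ) * x), ?_, ?_, ?_⟩
  · exact (memLp_top_of_bound hc.aestronglyMeasurable 1
      (Filter.Eventually.of_forall fun x => (hn x).le)).mono_exponent le_top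
  · unfold l2normT
    simp only [hn]; simp
  · have : {x ∈ Set.Ioc (0:ℝ) 1 | 1 / 2 < Tmax N σ (fun x : ℝ => ∑ I ∈ ({()} : Finset Unit),
        ∑ b ∈ ({()} : Finset Unit), (1 : ℂ) * ex (((1 : ℤ) : ℝ) * x)) x} = Set.Ioc (0:ℝ) 1 := by
      ext x
      refine ⟨fun h => h.1, fun h => ⟨h, ?_⟩⟩
      refine lt_of_lt_of_le ?_ (hT 0 x)
      have e : (({()} : Finset Unit).filter fun _ => 0 ≤ 0) = {()} := by simp
      rw [e, hn x]; norm_num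
    rw [this]; simp

/-- For every `N > 1` there is a permutation `σ` of `{1,…,N}` with
`‖T_{σ,N}‖_{L²→L^{2,∞}} ≥ c √(log N)`: there are `f` with `‖f‖₂ ≤ 1` and `λ > 0` with
`λ · |{T_{σ,N} f > λ}|^{1/2} ≥ c √(log N)`. -/
theorem statement1 :
    ∃ c : ℝ, 0 < c ∧ ∀ N : ℕ, 1 < N →
      ∃ σ : ℕ → ℕ, Set.BijOn σ (Set.Icc 1 N) (Set.Icc 1 N) ∧
        ∃ f : ℝ → ℂ, MemLp f 2 (volume.restrict (Set.Ioc (0:ℝ) 1)) ∧ l2normT f ≤ 1 ∧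
          ∃ lam : ℝ, 0 < lam ∧
            c * Real.sqrt (Real.log N) ≤
              lam * ((volume {x ∈ Set.Ioc (0:ℝ) 1 | lam < Tmax N σ f x}).toReal) ^ ((1:ℝ)/2) := by

  refine ⟨1 / 6144, by norm_num, fun N hN => ?_⟩
  have hNpos : (0 : ℝ) < N := by positivity
  have hlog2 : Real.log 2 ≤ 1 := by have := Real.log_two_lt_d9; linarith
  by_cases h : N < 2048
  · obtain ⟨σ, hσ, f, hf, hf1, hv⟩ := small_case N hN
    refine ⟨σ, hσ, f, hf, hf1, 1 / 2, by norm_num, ?_⟩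
    rw [hv, Real.one_rpow]
    have h1 : Real.log N ≤ 16 := by
      have h2 : Real.log N ≤ Real.log (2 ^ 11) :=
        Real.log_le_log hNpos (by norm_num; exact_mod_cast h.le)
      rw [Real.log_pow] at h2
      push_cast at h2; linarith
    have h3 : Real.sqrt (Real.log N) ≤ 4 := by
      rw [Real.sqrt_le_left (by norm_num)]; linarith
    linarith
  · push Not at h
    set n := Nat.log 4 (N / 512) with hn
    have hne : N / 512 ≠ 0 := by omega
    have h1 : 1 ≤ n := Nat.log_pos (by norm_num) (by omega)
    have h2 : 4 ^ n ≤ N / 512 := Nat.pow_log_le_self 4 hne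
    have h3 : N / 512 < 4 ^ (n + 1) := Nat.lt_pow_succ_log_self (by norm_num) _
    obtain ⟨σ, hσ, f, hf, hf1, hv⟩ := main_case n N h1 (by omega)
    have hnr : (1 : ℝ) ≤ n := by exact_mod_cast h1
    refine ⟨σ, hσ, f, hf, hf1, Real.sqrt n / 6, by positivity, ?_⟩
    have h4 : N ≤ 2 ^ (2 * n + 11) := by
      have : 2 ^ (2 * n + 11) = 512 * 4 ^ (n + 1) := by
        rw [pow_add, pow_mul]; norm_num; ring
      omega
    have h5 : Real.log N ≤ 16 * n := by
      have h6 : Real.log N ≤ Real.log (2 ^ (2 * n + 11)) :=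
        Real.log_le_log hNpos (by exact_mod_cast h4)
      rw [Real.log_pow] at h6
      push_cast at h6
      nlinarith
    have h7 : Real.sqrt (Real.log N) ≤ 4 * Real.sqrt n := by
      rw [show 4 * Real.sqrt n = Real.sqrt (16 * n) by
        rw [Real.sqrt_mul (by norm_num), show (16 : ℝ) = 4 ^ 2 by norm_num,
          Real.sqrt_sq (by norm_num)]]
      exact Real.sqrt_le_sqrt h5
    have h8 : (1 / 256 : ℝ) ≤
        ((volume {x ∈ Set.Ioc (0:ℝ) 1 | Real.sqrt n / 6 < Tmax N σ f x}).toReal) ^ ((1:ℝ)/2) := by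
      rw [← Real.sqrt_eq_rpow]
      apply Real.le_sqrt_of_sq_le
      refine le_trans ?_ hv
      norm_num
    have h9 : Real.sqrt n / 6 * (1 / 256) ≤ Real.sqrt n / 6 *
        ((volume {x ∈ Set.Ioc (0:ℝ) 1 | Real.sqrt n / 6 < Tmax N σ f x}).toReal) ^ ((1:ℝ)/2) := by
      gcongr
    linarith
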